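/- Let d ≥ 2, let u be a fixed unit vector in ℝ^d, and let b be a random vector distributed according to the uniform probability measure on the unit sphere S^{d-1}. Then the random variable ⟨u, b⟩² follows the Beta distribution with parameters 1/2 and (d−1)/2; i.e., the pushforward of the uniform sphere measure under the map b ↦ ⟨u, b⟩² equals the Beta(1/2, (d−1)/2) measure on [0,1]. -/

import Mathlib

open MeasureTheory Metric
open scoped RealInnerProductSpace

/-- The uniform probability measure on the unit sphere `S^{d-1} ⊆ ℝ^d`:
the rotation-invariant surface (cone) measure induced by Lebesgue measure,
normalized to be a probability measure. -/
noncomputable def uniformSphere (d : ℕ) :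
    Measure (sphere (0 : EuclideanSpace ℝ (Fin d)) 1) :=
  ((volume : Measure (EuclideanSpace ℝ (Fin d))).toSphere Set.univ)⁻¹ •
    (volume : Measure (EuclideanSpace ℝ (Fin d))).toSphere

/-- The Beta function `B(a, b) = ∫_0^1 t^(a-1) (1-t)^(b-1) dt`. -/
noncomputable def realBetaFun (a b : ℝ) : ℝ :=
  ∫ t in Set.Ioo (0 : ℝ) 1, t ^ (a - 1) * (1 - t) ^ (b - 1)

/-- The Beta(a, b) distribution on `[0,1]`, with density
`t^(a-1) (1-t)^(b-1) / B(a,b)` with respect to Lebesgue measure. -/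
noncomputable def betaMeasure (a b : ℝ) : Measure ℝ :=
  volume.withDensity
    ((Set.Ioo (0 : ℝ) 1).indicator fun t =>
      ENNReal.ofReal (t ^ (a - 1) * (1 - t) ^ (b - 1) / realBetaFun a b))


open Polynomial in
theorem aux_moments (μ ν : Measure ℝ) [IsProbabilityMeasure μ] [IsProbabilityMeasure ν]
    (hμ : ∀ᵐ x ∂μ, x ∈ Set.Icc (0 : ℝ) 1) (hν : ∀ᵐ x ∂ν, x ∈ Set.Icc (0 : ℝ) 1)
    (h : ∀ k : ℕ, ∫ x, x ^ k ∂μ = ∫ x, x ^ k ∂ν) : μ = ν := by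
  have hpow : ∀ (ρ : Measure ℝ) [IsProbabilityMeasure ρ], (∀ᵐ x ∂ρ, x ∈ Set.Icc (0 : ℝ) 1) →
      ∀ k : ℕ, Integrable (fun x : ℝ => x ^ k) ρ := by
    intro ρ _ hρ k
    refine Integrable.of_bound (C := 1) (by fun_prop) ?_
    filter_upwards [hρ] with x hx
    rw [Real.norm_eq_abs, abs_of_nonneg (pow_nonneg hx.1 _)]
    exact pow_le_one₀ hx.1 hx.2
  have hpoly : ∀ (ρ : Measure ℝ) [IsProbabilityMeasure ρ], (∀ᵐ x ∂ρ, x ∈ Set.Icc (0 : ℝ) 1) →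
      ∀ p : ℝ[X], Integrable (fun x : ℝ => p.eval x) ρ := by
    intro ρ _ hρ p
    simp_rw [eval_eq_sum_range]
    exact integrable_finsetSum _ fun i _ => (hpow ρ hρ i).const_mul _
  have hpe : ∀ p : ℝ[X], ∫ x, p.eval x ∂μ = ∫ x, p.eval x ∂ν := by
    intro p
    simp_rw [eval_eq_sum_range]
    rw [integral_finsetSum _ fun i _ => (hpow μ hμ i).const_mul _,
      integral_finsetSum _ fun i _ => (hpow ν hν i).const_mul _]
    simp_rw [integral_const_mul, h]
  refine ext_of_forall_integral_eq_of_IsFiniteMeasure fun f => ?_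
  have hb : ∀ (ρ : Measure ℝ) [IsProbabilityMeasure ρ], (∀ᵐ x ∂ρ, x ∈ Set.Icc (0 : ℝ) 1) →
      ∀ (p : ℝ[X]) (ε : ℝ), (∀ x ∈ Set.Icc (0:ℝ) 1, |p.eval x - f x| < ε) →
        |∫ x, p.eval x ∂ρ - ∫ x, f x ∂ρ| ≤ ε := by
    intro ρ _ hρ p ε hp
    rw [← integral_sub (hpoly ρ hρ p) (f.integrable ρ), ← Real.norm_eq_abs]
    have := norm_integral_le_of_norm_le_const (μ := ρ) (f := fun x => p.eval x - f x) (C := ε)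
      (by filter_upwards [hρ] with x hx using (hp x hx).le)
    simpa using this
  refine eq_of_abs_sub_le_all fun ε hε => ?_
  obtain ⟨p, hp⟩ := exists_polynomial_near_of_continuousOn 0 1 f f.continuous.continuousOn
    (ε / 2) (half_pos hε)
  have h1 := abs_le.1 (hb μ hμ p _ hp)
  have h2 := abs_le.1 (hb ν hν p _ hp)
  rw [hpe p] at h1
  rw [abs_le]
  constructor <;> linarith [h1.1, h1.2, h2.1, h2.2]

theorem aux_beta_int {a b : ℝ} (ha : 0 < a) (hb : 0 < b) :
    realBetaFun a b = ProbabilityTheory.beta a b := by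
  rw [realBetaFun, ProbabilityTheory.beta_eq_betaIntegralReal a b ha hb,
      Complex.betaIntegral, intervalIntegral.integral_of_le (by norm_num),
      ← integral_Ioc_eq_integral_Ioo, ← RCLike.re_to_complex, ← integral_re]
  · refine setIntegral_congr_fun measurableSet_Ioc fun x ⟨hx1, hx₂⟩ ↦ ?_
    norm_cast
    rw [← Complex.ofReal_cpow, ← Complex.ofReal_cpow, RCLike.re_to_complex,
        Complex.re_mul_ofReal, Complex.ofReal_re]
    all_goals linarith
  · convert! Complex.betaIntegral_convergent (u := a) (v := b) (by simpa) (by simpa)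
    rw [intervalIntegrable_iff_integrableOn_Ioc_of_le (by simp), IntegrableOn]

theorem aux_beta_eq {a b : ℝ} (ha : 0 < a) (hb : 0 < b) :
    betaMeasure a b = ProbabilityTheory.betaMeasure a b := by
  rw [betaMeasure, ProbabilityTheory.betaMeasure, aux_beta_int ha hb]
  congr 1
  ext t
  rw [ProbabilityTheory.betaPDF_eq]
  by_cases ht : t ∈ Set.Ioo (0:ℝ) 1
  · rw [Set.indicator_of_mem ht, if_pos (Set.mem_Ioo.1 ht)]
    congr 1
    ring
  · rw [Set.indicator_of_notMem ht, if_neg (fun h => ht (Set.mem_Ioo.2 h))]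
    simp

theorem aux_beta_moment {a b : ℝ} (ha : 0 < a) (hb : 0 < b) (k : ℕ) :
    ∫ x, x ^ k ∂(betaMeasure a b) =
      ProbabilityTheory.beta (a + k) b / ProbabilityTheory.beta a b := by
  have ha' : 0 < a + k := by positivity
  have hp := ProbabilityTheory.beta_pos ha hb
  rw [betaMeasure, integral_withDensity_eq_integral_toReal_smul, aux_beta_int ha hb,
    ← aux_beta_int ha' hb, realBetaFun, ← integral_div, ← integral_indicator measurableSet_Ioo]
  · refine integral_congr_ae (.of_forall fun t => ?_)
    simp only [Set.indicator]
    split_ifs with ht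
    · have h1 : 0 < 1 - t := by linarith [ht.2]
      have h0 := ht.1
      rw [ENNReal.toReal_ofReal (by positivity), smul_eq_mul,
        show a + k - 1 = (a - 1) + k by ring, Real.rpow_add_natCast h0.ne']
      ring
    · simp
  · exact Measurable.indicator (by fun_prop) measurableSet_Ioo
  · refine .of_forall fun t => ?_
    simp only [Set.indicator]
    split_ifs <;> simp

theorem aux_beta_supp (a b : ℝ) : ∀ᵐ x ∂(betaMeasure a b), x ∈ Set.Icc (0 : ℝ) 1 := by
  rw [betaMeasure, withDensity_indicator measurableSet_Ioo]
  refine (withDensity_absolutelyContinuous _ _).ae_le ?_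
  filter_upwards [ae_restrict_mem measurableSet_Ioo] with x hx using Set.Ioo_subset_Icc_self hx

theorem aux_gauss (k : ℕ) :
    ∫ x in Set.Ioi (0:ℝ), x ^ k * Real.exp (-x ^ 2) = 1 / 2 * Real.Gamma (((k:ℝ) + 1) / 2) := by
  have := integral_rpow_mul_exp_neg_rpow (p := 2) (q := k) (by norm_num)
    (by linarith [Nat.cast_nonneg (α := ℝ) k])
  simpa using this

theorem aux_gauss_full (k : ℕ) :
    ∫ x : ℝ, x ^ (2 * k) * Real.exp (-x ^ 2) = Real.Gamma (1 / 2 + k) := by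
  have := integral_comp_abs (f := fun x : ℝ => x ^ (2 * k) * Real.exp (-x ^ 2))
  simp only [sq_abs, pow_mul] at this
  simp only [pow_mul]
  rw [this]
  simp only [← pow_mul]
  rw [aux_gauss]
  push_cast
  rw [show (2 * (k:ℝ) + 1) / 2 = 1 / 2 + k by ring]
  ring

theorem aux_polar {E : Type*} [NormedAddCommGroup E] [InnerProductSpace ℝ E] [MeasurableSpace E]
    [BorelSpace E] [FiniteDimensional ℝ E] [Nontrivial E] (μ : Measure E) [μ.IsAddHaarMeasure]
    (d : ℕ) (hd : 2 ≤ d) (hfr : Module.finrank ℝ E = d) (u : E) (k : ℕ) :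
    ∫ x, ⟪u, x⟫ ^ (2 * k) * Real.exp (-‖x‖ ^ 2) ∂μ =
      (∫ b : sphere (0 : E) 1, (⟪u, (b : E)⟫ ^ 2) ^ k ∂μ.toSphere) *
      (1 / 2 * Real.Gamma ((d : ℝ) / 2 + k)) := by
  have hr : ∫ r : Set.Ioi (0 : ℝ), r.1 ^ (2 * k) * Real.exp (-r.1 ^ 2)
      ∂(Measure.volumeIoiPow (Module.finrank ℝ E - 1)) = 1 / 2 * Real.Gamma ((d : ℝ) / 2 + k) := by
    simp only [Measure.volumeIoiPow, ENNReal.ofReal]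
    rw [integral_withDensity_eq_integral_smul
        ((measurable_subtype_coe.pow_const _).real_toNNReal),
      integral_subtype_comap measurableSet_Ioi fun a : ℝ ↦
        Real.toNNReal (a ^ (Module.finrank ℝ E - 1)) • (a ^ (2 * k) * Real.exp (-a ^ 2)),
      hfr]
    have h2 := aux_gauss (d - 1 + 2 * k)
    rw [Nat.cast_add, Nat.cast_sub (by lia)] at h2
    push_cast at h2
    rw [show ((d:ℝ) - 1 + 2 * k + 1) / 2 = d / 2 + k by ring] at h2
    rw [← h2]
    refine setIntegral_congr_fun measurableSet_Ioi fun x hx ↦ ?_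
    rw [NNReal.smul_def, Real.coe_toNNReal _ (pow_nonneg (le_of_lt hx) _), smul_eq_mul]
    ring
  rw [← hr, ← integral_prod_mul
      (fun b : sphere (0 : E) 1 => (⟪u, (b : E)⟫ ^ 2) ^ k)
      (fun r : Set.Ioi (0 : ℝ) => r.1 ^ (2 * k) * Real.exp (-r.1 ^ 2)),
    ← μ.measurePreserving_homeomorphUnitSphereProd.integral_comp
        (Homeomorph.measurableEmbedding _)]
  have h3 := integral_subtype_comap (μ := μ) (measurableSet_singleton (0 : E)).compl
    (fun x : E => ⟪u, x⟫ ^ (2 * k) * Real.exp (-‖x‖ ^ 2))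
  rw [restrict_compl_singleton] at h3
  rw [← h3]
  refine integral_congr_ae (.of_forall fun x => ?_)
  have hx : ‖(x : E)‖ ≠ 0 := norm_ne_zero_iff.2 x.2
  simp only [homeomorphUnitSphereProd_apply_fst_coe, homeomorphUnitSphereProd_apply_snd_coe,
    inner_smul_right]
  rw [pow_mul, pow_mul, ← mul_assoc, ← mul_pow, ← mul_pow]
  congr 3
  field_simp

theorem aux_cart (d : ℕ) (hd : 2 ≤ d) (u : EuclideanSpace ℝ (Fin d)) (hu : ‖u‖ = 1) :
    ∃ C : ℝ, C ≠ 0 ∧ ∀ k : ℕ,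
      ∫ x : EuclideanSpace ℝ (Fin d), ⟪u, x⟫ ^ (2 * k) * Real.exp (-‖x‖ ^ 2) =
        C * Real.Gamma (1 / 2 + k) := by
  classical
  let i₀ : Fin d := ⟨0, by lia⟩
  have ho : Orthonormal ℝ (Set.domRestrict ({i₀} : Set (Fin d)) (fun _ => u)) := by
    constructor
    · intro i; simpa using hu
    · intro i j hij
      exact absurd (Subsingleton.elim i j) hij
  obtain ⟨b, hb⟩ := ho.exists_orthonormalBasis_extension_of_card_eq (by simp)
  have hb0 : b i₀ = u := hb i₀ rfl
  have hmp := b.measurePreserving_repr_symm.comp (PiLp.volume_preserving_toLp (Fin d))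
  refine ⟨Real.sqrt Real.pi ^ (d - 1), by positivity, fun k => ?_⟩
  have hint : ∫ x : EuclideanSpace ℝ (Fin d), ⟪u, x⟫ ^ (2 * k) * Real.exp (-‖x‖ ^ 2) =
      ∫ y : Fin d → ℝ, ∏ i, (y i ^ (if i = i₀ then 2 * k else 0) * Real.exp (-y i ^ 2)) := by
    rw [← hmp.integral_comp (b.repr.symm.toHomeomorph.measurableEmbedding.comp
      (MeasurableEquiv.toLp 2 (Fin d → ℝ)).measurableEmbedding)]
    refine integral_congr_ae (.of_forall fun y => ?_)
    simp only [Function.comp_apply]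
    rw [Finset.prod_mul_distrib, ← Real.exp_sum, ← hb0, ← b.repr_apply_apply]
    simp [EuclideanSpace.real_norm_sq_eq, pow_ite]
  rw [hint, integral_fintype_prod_volume_eq_prod
    (fun i (t : ℝ) => t ^ (if i = i₀ then 2 * k else 0) * Real.exp (-t ^ 2)),
    ← Finset.mul_prod_erase _ _ (Finset.mem_univ i₀)]
  rw [Finset.prod_congr rfl (g := fun _ => Real.sqrt Real.pi)]
  · simp only [if_true, aux_gauss_full]
    simp [mul_comm]
  · intro i hi
    have := integral_gaussian 1
    simpa [Finset.ne_of_mem_erase hi] using this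

/-- If `u` is a fixed unit vector in `ℝ^d` (`d ≥ 2`) and `b` is uniformly distributed
on the unit sphere, then `⟪u, b⟫²` has the Beta(1/2, (d-1)/2) distribution. -/
theorem sq_inner_uniformSphere_beta
    (d : ℕ) (hd : 2 ≤ d) (u : EuclideanSpace ℝ (Fin d)) (hu : ‖u‖ = 1) :
    Measure.map
        (fun b : sphere (0 : EuclideanSpace ℝ (Fin d)) 1 =>
          ⟪u, (b : EuclideanSpace ℝ (Fin d))⟫ ^ 2) (uniformSphere d)
      = betaMeasure (1 / 2) (((d : ℝ) - 1) / 2) := by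
  have : Nontrivial (Fin d) := Fin.nontrivial_iff_two_le.2 hd
  have hd' : (2 : ℝ) ≤ d := by exact_mod_cast hd
  have ha : (0 : ℝ) < 1 / 2 := by norm_num
  have hb : 0 < ((d : ℝ) - 1) / 2 := by linarith
  have hm : Measurable (fun b : sphere (0 : EuclideanSpace ℝ (Fin d)) 1 =>
      ⟪u, (b : EuclideanSpace ℝ (Fin d))⟫ ^ 2) := by fun_prop
  have hne : (volume : Measure (EuclideanSpace ℝ (Fin d))).toSphere ≠ 0 :=
    Measure.toSphere_ne_zero _
  have hP : IsProbabilityMeasure (uniformSphere d) := by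
    constructor
    rw [uniformSphere, Measure.smul_apply, smul_eq_mul]
    exact ENNReal.inv_mul_cancel (Measure.measure_univ_ne_zero.2 hne) (measure_ne_top _ _)
  have hQ : IsProbabilityMeasure (betaMeasure (1 / 2) (((d : ℝ) - 1) / 2)) := by
    rw [aux_beta_eq ha hb]
    exact ProbabilityTheory.isProbabilityMeasureBeta ha hb
  have hP' := Measure.isProbabilityMeasure_map (μ := uniformSphere d) hm.aemeasurable
  refine aux_moments _ _ ?_ (aux_beta_supp _ _) fun k => ?_
  · refine (ae_map_iff (p := fun x => x ∈ Set.Icc (0 : ℝ) 1) hm.aemeasurable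
      measurableSet_Icc).2 ?_
    refine .of_forall fun b => ⟨sq_nonneg _, ?_⟩
    have h := abs_real_inner_le_norm u (b : EuclideanSpace ℝ (Fin d))
    rw [hu, norm_eq_of_mem_sphere, one_mul] at h
    exact (sq_le_one_iff_abs_le_one _).2 h
  · rw [integral_map hm.aemeasurable (by fun_prop), aux_beta_moment ha hb, uniformSphere,
      integral_smul_measure]
    obtain ⟨C, hC, h⟩ := aux_cart d hd u hu
    have hk := h k
    have h0 := h 0
    rw [aux_polar _ d hd (by simp)] at hk h0
    simp only [pow_zero, integral_const, smul_eq_mul, mul_one, Nat.cast_zero, add_zero] at h0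
    rw [ENNReal.toReal_inv, ← measureReal_def, smul_eq_mul]
    set m := ∫ b : sphere (0 : EuclideanSpace ℝ (Fin d)) 1,
        (⟪u, (b : EuclideanSpace ℝ (Fin d))⟫ ^ 2) ^ k
        ∂(volume : Measure (EuclideanSpace ℝ (Fin d))).toSphere
    set M := (volume : Measure (EuclideanSpace ℝ (Fin d))).toSphere.real Set.univ
    have g1 : 0 < Real.Gamma ((d : ℝ) / 2 + k) := Real.Gamma_pos_of_pos (by positivity)
    have g2 : 0 < Real.Gamma ((d : ℝ) / 2) := Real.Gamma_pos_of_pos (by positivity)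
    have g3 : 0 < Real.Gamma (1 / 2 : ℝ) := Real.Gamma_pos_of_pos (by positivity)
    have g4 : 0 < Real.Gamma (((d : ℝ) - 1) / 2) := Real.Gamma_pos_of_pos hb
    rw [ProbabilityTheory.beta, ProbabilityTheory.beta,
      show 1 / 2 + (k : ℝ) + ((d : ℝ) - 1) / 2 = d / 2 + k by ring,
      show 1 / 2 + ((d : ℝ) - 1) / 2 = d / 2 by ring]
    have hm' : m = C * Real.Gamma (1 / 2 + k) * 2 / Real.Gamma ((d : ℝ) / 2 + k) := by
      rw [← hk]; field_simp
    have hM' : M = C * Real.Gamma (1 / 2) * 2 / Real.Gamma ((d : ℝ) / 2) := by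
      rw [← h0]; field_simp
    rw [hm', hM']
    generalize Real.Gamma (1 / 2 : ℝ) = z at *
    field_simp
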